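/- Let A be a noetherian ℤ_p-algebra, M and N finitely generated A-modules, and ψ : M → N an A-linear map such that ψ ⊗ id : M ⊗_{ℤ_p} ℚ_p → N ⊗_{ℤ_p} ℚ_p is an isomorphism. Then the induced map on p-adic completions, ψ̂ ⊗ id : M̂ ⊗_{ℤ_p} ℚ_p → N̂ ⊗_{ℤ_p} ℚ_p, is also an isomorphism. -/

import Mathlib

open LocalizedModule

/-- A localized linear map is injective iff its kernel is torsion with respect to the submonoid. -/
theorem IsLocalizedModule.map_injective_iff_forall_exists_smul_eq_zero
    {R M M' N N' : Type*} [CommRing R] (S : Submonoid R)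
    [AddCommGroup M] [Module R M] [AddCommGroup M'] [Module R M']
    [AddCommGroup N] [Module R N] [AddCommGroup N'] [Module R N']
    (f : M →ₗ[R] M') (g : N →ₗ[R] N') [IsLocalizedModule S f] [IsLocalizedModule S g]
    (h : M →ₗ[R] N) :
    Function.Injective (IsLocalizedModule.map S f g h) ↔
      ∀ x, h x = 0 → ∃ s : S, s • x = 0 := by
  rw [injective_iff_map_eq_zero]
  refine ⟨fun H x hx ↦ ?_, fun H y hy ↦ ?_⟩
  · rw [← IsLocalizedModule.eq_zero_iff S f]
    exact H _ (by rw [IsLocalizedModule.map_apply, hx, map_zero])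
  · obtain ⟨⟨x, s⟩, rfl⟩ := IsLocalizedModule.mk'_surjective S f y
    simp only [Function.uncurry_apply_pair, IsLocalizedModule.map_mk',
      IsLocalizedModule.mk'_eq_zero'] at hy ⊢
    obtain ⟨t, ht⟩ := hy
    obtain ⟨u, hu⟩ := H (t • x) (by rw [LinearMap.map_smul_of_tower, ht])
    exact ⟨u * t, by rw [mul_smul, hu]⟩

/-- A localized linear map is surjective iff its cokernel is torsion with respect to the
submonoid. -/
theorem IsLocalizedModule.map_surjective_iff_forall_exists_smul_mem_range
    {R M M' N N' : Type*} [CommRing R] (S : Submonoid R)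
    [AddCommGroup M] [Module R M] [AddCommGroup M'] [Module R M']
    [AddCommGroup N] [Module R N] [AddCommGroup N'] [Module R N']
    (f : M →ₗ[R] M') (g : N →ₗ[R] N') [IsLocalizedModule S f] [IsLocalizedModule S g]
    (h : M →ₗ[R] N) :
    Function.Surjective (IsLocalizedModule.map S f g h) ↔
      ∀ y, ∃ s : S, s • y ∈ LinearMap.range h := by
  refine ⟨fun H y ↦ ?_, fun H z ↦ ?_⟩
  · obtain ⟨w, hw⟩ := H (g y)
    obtain ⟨⟨x, s⟩, rfl⟩ := IsLocalizedModule.mk'_surjective S f w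
    rw [Function.uncurry_apply_pair, IsLocalizedModule.map_mk', ← IsLocalizedModule.mk'_one S g,
      IsLocalizedModule.mk'_eq_mk'_iff] at hw
    obtain ⟨t, ht⟩ := hw
    refine ⟨t * s, t • x, ?_⟩
    rw [LinearMap.map_smul_of_tower, mul_smul, ht, one_smul]
  · obtain ⟨⟨y, s⟩, rfl⟩ := IsLocalizedModule.mk'_surjective S g z
    obtain ⟨t, x, hx⟩ := H y
    exact ⟨IsLocalizedModule.mk' f x (t * s), by
      rw [IsLocalizedModule.map_mk', hx, IsLocalizedModule.mk'_cancel_left,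
        Function.uncurry_apply_pair]⟩

/-- If every element of a finitely generated submodule `P` is moved into `Q` by some element of
the submonoid `S`, then a single element of `S` moves all of `P` into `Q`. -/
theorem Submodule.FG.exists_forall_smul_mem {R M : Type*} [CommRing R] (S : Submonoid R)
    [AddCommGroup M] [Module R M] {P Q : Submodule R M} (hP : P.FG)
    (h : ∀ x ∈ P, ∃ s : S, s • x ∈ Q) : ∃ s : S, ∀ x ∈ P, s • x ∈ Q := by
  induction P, hP using Submodule.fg_induction with
  | singleton x =>
    obtain ⟨s, hs⟩ := h x (Submodule.mem_span_singleton_self x)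
    refine ⟨s, fun y hy ↦ ?_⟩
    obtain ⟨a, rfl⟩ := Submodule.mem_span_singleton.mp hy
    rw [smul_comm]
    exact Q.smul_mem a hs
  | sup P₁ P₂ _ _ ih₁ ih₂ =>
    obtain ⟨s, hs⟩ := ih₁ fun x hx ↦ h x (Submodule.mem_sup_left hx)
    obtain ⟨t, ht⟩ := ih₂ fun x hx ↦ h x (Submodule.mem_sup_right hx)
    refine ⟨s * t, fun x hx ↦ ?_⟩
    obtain ⟨y, hy, z, hz, rfl⟩ := Submodule.mem_sup.mp hx
    rw [smul_add]
    refine Q.add_mem ?_ ?_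
    · rw [mul_comm, mul_smul]
      exact Q.smul_of_tower_mem t (hs y hy)
    · rw [mul_smul]
      exact Q.smul_of_tower_mem s (ht z hz)

/-- If `s` kills the kernel of `f` and `t` kills its cokernel, then `s * t` kills the kernel of the
map induced by `f` on adic completions. -/
theorem AdicCompletion.mul_smul_eq_zero_of_map_eq_zero {R M N : Type*} [CommRing R] (I : Ideal R)
    [AddCommGroup M] [Module R M] [AddCommGroup N] [Module R N] {f : M →ₗ[R] N} {s t : R}
    (hs : ∀ x, f x = 0 → s • x = 0) (ht : ∀ y, t • y ∈ LinearMap.range f)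
    {x : AdicCompletion I M} (hx : AdicCompletion.map I f x = 0) : (s * t) • x = 0 := by
  induction x using AdicCompletion.induction_on with
  | _ a =>
    rw [← map_smul]
    refine AdicCompletion.mk_zero_of I M _ ⟨0, fun n _ ↦ ⟨n, le_rfl, n, le_rfl, ?_⟩⟩
    have hn : f (a n) ∈ (I ^ n • ⊤ : Submodule R N) := by
      simpa using congrArg (fun y ↦ y.val n) hx
    have hmem : t • f (a n) ∈ Submodule.map f (I ^ n • ⊤ : Submodule R M) := by
      rw [Submodule.map_smul'', Submodule.map_top]
      refine Submodule.smul_induction_on hn (fun r hr y _ ↦ ?_) fun y z hy hz ↦ ?_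
      · rw [smul_comm]
        exact Submodule.smul_mem_smul hr (ht y)
      · rw [smul_add]
        exact add_mem hy hz
    obtain ⟨m, hm, hfm⟩ := hmem
    have hzero : s • (t • a n - m) = 0 := hs _ (by rw [map_sub, map_smul, hfm, sub_self])
    rw [smul_sub, sub_eq_zero, ← mul_smul] at hzero
    change (s * t) • a n ∈ _
    rw [hzero]
    exact Submodule.smul_mem _ s hm

/-- If `t` kills the cokernel of `f`, then it kills the cokernel of the map induced by `f` on adic
completions. -/
theorem AdicCompletion.smul_mem_range_map {R M N : Type*} [CommRing R] (I : Ideal R)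
    [AddCommGroup M] [Module R M] [AddCommGroup N] [Module R N] {f : M →ₗ[R] N} {t : R}
    (ht : ∀ y, t • y ∈ LinearMap.range f) (y : AdicCompletion I N) :
    ∃ x, AdicCompletion.map I f x = t • y := by
  let g : N →ₗ[R] LinearMap.range f := (LinearMap.lsmul R N t).codRestrict _ ht
  obtain ⟨x, hx⟩ := AdicCompletion.map_surjective I f.surjective_rangeRestrict
    (AdicCompletion.map I g y)
  refine ⟨x, ?_⟩
  have := congrArg (AdicCompletion.map I (LinearMap.range f).subtype) hx
  rw [AdicCompletion.map_comp_apply, AdicCompletion.map_comp_apply] at this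
  refine this.trans ?_
  induction y using AdicCompletion.induction_on with
  | _ b => rfl

/-- Let `A` be a noetherian `ℤ_p`-algebra, `M`, `N` finitely generated
`A`-modules and `ψ : M → N` an `A`-linear map which becomes an isomorphism
after tensoring with `ℚ_p` (equivalently, after inverting `p`).  Then the
induced map on `p`-adic completions also becomes an isomorphism after
tensoring with `ℚ_p` (i.e. after inverting `p`). -/
theorem completion_iso_of_iso_after_inverting_p (p : ℕ) [Fact p.Prime]
    {A : Type*} [CommRing A] [Algebra ℤ_[p] A] [IsNoetherianRing A]
    {M N : Type*} [AddCommGroup M] [Module A M] [AddCommGroup N] [Module A N]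
    [Module.Finite A M] [Module.Finite A N] (ψ : M →ₗ[A] N)
    (h : Function.Bijective
      (IsLocalizedModule.map (Submonoid.powers (p : A))
        (mkLinearMap (Submonoid.powers (p : A)) M)
        (mkLinearMap (Submonoid.powers (p : A)) N) ψ)) :
    Function.Bijective
      (IsLocalizedModule.map (Submonoid.powers (p : A))
        (mkLinearMap (Submonoid.powers (p : A)) (AdicCompletion (Ideal.span {(p : A)}) M))
        (mkLinearMap (Submonoid.powers (p : A)) (AdicCompletion (Ideal.span {(p : A)}) N))
        ((AdicCompletion.map (Ideal.span {(p : A)}) ψ).restrictScalars A)) := by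
  rw [Function.Bijective, IsLocalizedModule.map_injective_iff_forall_exists_smul_eq_zero,
    IsLocalizedModule.map_surjective_iff_forall_exists_smul_mem_range] at h ⊢
  obtain ⟨s, hs⟩ := (IsNoetherian.noetherian (LinearMap.ker ψ)).exists_forall_smul_mem
    (Submonoid.powers (p : A)) (Q := ⊥) h.1
  obtain ⟨t, ht⟩ := (Module.Finite.fg_top (R := A) (M := N)).exists_forall_smul_mem
    (Submonoid.powers (p : A)) (Q := LinearMap.range ψ) fun y _ ↦ h.2 y
  have ht' (y : N) : (t : A) • y ∈ LinearMap.range ψ := ht y trivial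
  exact ⟨fun x hx ↦ ⟨s * t, AdicCompletion.mul_smul_eq_zero_of_map_eq_zero _ hs ht' hx⟩,
    fun y ↦ ⟨t, AdicCompletion.smul_mem_range_map _ ht' y⟩⟩
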